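/- Let X be a finite set with #X ≥ 2. The set of elements of F(X) which lie in a proper free factor of F(X), i.e., the set {w ∈ F(X) : w ∈ α(⟨S⟩) for some α ∈ Aut F(X) and some proper subset S ⊊ X}, is exponentially F(X)-negligible. -/

import Mathlib

/-! Common definitions: cyclic length, Whitehead automorphisms, the sets TS, TS', L(ε),
balls, and exponential genericity in the free group F(X). -/

/-- The cyclic length ‖w‖_X : the minimum of |g w g⁻¹|_X over g ∈ F(X). -/
noncomputable def cyclicLength {X : Type} [DecidableEq X] (w : FreeGroup X) : ℕ :=
  sInf (Set.range fun g : FreeGroup X => FreeGroup.norm (g * w * g⁻¹))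

/-- w is cyclically reduced if |w|_X = ‖w‖_X. -/
def CyclicallyReduced {X : Type} [DecidableEq X] (w : FreeGroup X) : Prop :=
  FreeGroup.norm w = cyclicLength w

/-- The set X^± = X ∪ X⁻¹ of letters, viewed inside F(X). -/
def Xpm (X : Type) : Set (FreeGroup X) :=
  (Set.range fun x : X => FreeGroup.of x) ∪ (Set.range fun x : X => (FreeGroup.of x)⁻¹)

/-- σ is a type I (relabeling) Whitehead automorphism: there is a bijection π of X^±
commuting with inversion such that σ(x) = π(x) for all x ∈ X. -/
def IsTypeI {X : Type} (σ : MulAut (FreeGroup X)) : Prop :=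
  ∃ π : FreeGroup X → FreeGroup X,
    Set.BijOn π (Xpm X) (Xpm X) ∧
    (∀ x ∈ Xpm X, π x⁻¹ = (π x)⁻¹) ∧
    (∀ x : X, σ (FreeGroup.of x) = π (FreeGroup.of x))

/-- σ is a type II Whitehead automorphism: there is a ∈ X^± with σ(a) = a and
σ(x) ∈ {x, xa, a⁻¹x, a⁻¹xa} for every x ∈ X^±. -/
def IsTypeII {X : Type} (σ : MulAut (FreeGroup X)) : Prop :=
  ∃ a ∈ Xpm X, σ a = a ∧
    ∀ x ∈ Xpm X, σ x = x ∨ σ x = x * a ∨ σ x = a⁻¹ * x ∨ σ x = a⁻¹ * x * a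

/-- σ is inner if it is conjugation by some element of F(X). -/
def IsInnerAut {X : Type} (σ : MulAut (FreeGroup X)) : Prop :=
  ∃ g : FreeGroup X, σ = MulAut.conj g

/-- w is a proper power if w = z^r for some z and some integer r ≥ 2. -/
def IsProperPower {X : Type} (w : FreeGroup X) : Prop :=
  ∃ z : FreeGroup X, ∃ r : ℕ, 2 ≤ r ∧ w = z ^ r

/-- TS is the set of cyclically reduced w that are not proper powers, whose cyclic length
is strictly increased by every non-inner type II Whitehead automorphism, and whose
conjugacy class is fixed by no non-identity type I Whitehead automorphism. -/
def TS (X : Type) [DecidableEq X] : Set (FreeGroup X) :=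
  {w | CyclicallyReduced w ∧ ¬ IsProperPower w ∧
    (∀ τ : MulAut (FreeGroup X), IsTypeII τ → ¬ IsInnerAut τ →
      cyclicLength w < cyclicLength (τ w)) ∧
    (∀ σ : MulAut (FreeGroup X), IsTypeI σ → σ ≠ 1 → ¬ IsConj w (σ w))}

/-- The set of elements of F(X) whose cyclic reduction lies in S. -/
def cyclicPreimage {X : Type} [DecidableEq X] (S : Set (FreeGroup X)) : Set (FreeGroup X) :=
  {w | ∃ g u : FreeGroup X, u ∈ S ∧ CyclicallyReduced u ∧ w = g * u * g⁻¹ ∧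
    FreeGroup.norm w = 2 * FreeGroup.norm g + FreeGroup.norm u}

/-- TS' is the set of elements of F(X) whose cyclic reduction lies in TS. -/
def TS' (X : Type) [DecidableEq X] : Set (FreeGroup X) :=
  cyclicPreimage (TS X)

/-- The ball B_n = {w ∈ F(X) : |w|_X ≤ n}. -/
def ballF (X : Type) [DecidableEq X] (n : ℕ) : Set (FreeGroup X) :=
  {w | FreeGroup.norm w ≤ n}

/-- S is exponentially T-generic: there are C > 0 and s ∈ (0,1) with
#((T∖S) ∩ B_n) ≤ C·s^n·#(T ∩ B_n) for all n. -/
def ExpGeneric {X : Type} [DecidableEq X] (S T : Set (FreeGroup X)) : Prop :=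
  ∃ C : ℝ, 0 < C ∧ ∃ s : ℝ, 0 < s ∧ s < 1 ∧
    ∀ n : ℕ, (((T \ S) ∩ ballF X n).ncard : ℝ) ≤ C * s ^ n * ((T ∩ ballF X n).ncard : ℝ)

/-- L(ε): the set of cyclically reduced w of length n ≥ 1 all of whose one-letter
frequencies lie in (1/(2N) − ε, 1/(2N) + ε) and all of whose cyclic two-letter
frequencies (for y ≠ x⁻¹) lie in (1/(2N(2N−1)) − ε, 1/(2N(2N−1)) + ε). -/
def Lset (X : Type) [Fintype X] [DecidableEq X] (ε : ℝ) : Set (FreeGroup X) :=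
  {w | CyclicallyReduced w ∧ 1 ≤ FreeGroup.norm w ∧
    ∀ x y : X × Bool, y ≠ (x.1, !x.2) →
      |((w.toWord.count x : ℝ) / (FreeGroup.norm w : ℝ)) -
        1 / (2 * (Fintype.card X : ℝ))| < ε ∧
      |(((w.toWord.zip (w.toWord.rotate 1)).count (x, y) : ℝ) / (FreeGroup.norm w : ℝ)) -
        1 / (2 * (Fintype.card X : ℝ) * (2 * (Fintype.card X : ℝ) - 1))| < ε}

section ChainCount

variable {A : Type} [Fintype A] [DecidableEq A] (R : A → A → Prop) [DecidableRel R]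

/-- The words of length `n` that can follow the letter `x` in an `R`-chain. -/
def chainsFrom : ℕ → A → Finset (List A)
  | 0, _ => {[]}
  | n + 1, x => (Finset.univ.filter (R x)).biUnion fun y => (chainsFrom n y).image (List.cons y)

theorem mem_chainsFrom {n : ℕ} {x : A} {l : List A} :
    l ∈ chainsFrom R n x ↔ l.length = n ∧ List.IsChain R (x :: l) := by
  induction n generalizing x l with
  | zero => cases l <;> simp [chainsFrom]
  | succ n ih =>
    cases l with
    | nil => simp [chainsFrom]
    | cons a l => simp [chainsFrom, ih]; tauto

theorem card_chainsFrom_le {v : A → ℝ} {r : ℝ} (hr : 0 ≤ r) (hv : ∀ x, 1 ≤ v x)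
    (h : ∀ x, ∑ y with R x y, v y ≤ r * v x) (n : ℕ) (x : A) :
    ((chainsFrom R n x).card : ℝ) ≤ r ^ n * v x := by
  induction n generalizing x with
  | zero => simpa [chainsFrom] using hv x
  | succ n ih =>
    have h1 : (chainsFrom R (n + 1) x).card ≤ ∑ y with R x y, (chainsFrom R n y).card :=
      Finset.card_biUnion_le.trans (Finset.sum_le_sum fun y _ => Finset.card_image_le)
    calc ((chainsFrom R (n + 1) x).card : ℝ)
        ≤ ∑ y with R x y, ((chainsFrom R n y).card : ℝ) := by exact_mod_cast h1
      _ ≤ ∑ y with R x y, r ^ n * v y := Finset.sum_le_sum fun y _ => ih y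
      _ = r ^ n * ∑ y with R x y, v y := by rw [Finset.mul_sum]
      _ ≤ r ^ n * (r * v x) := mul_le_mul_of_nonneg_left (h x) (pow_nonneg hr n)
      _ = r ^ (n + 1) * v x := by ring

theorem pow_le_card_chainsFrom {d : ℕ} (h : ∀ x, d ≤ (Finset.univ.filter (R x)).card)
    (n : ℕ) (x : A) : d ^ n ≤ (chainsFrom R n x).card := by
  induction n generalizing x with
  | zero => simp [chainsFrom]
  | succ n ih =>
    rw [chainsFrom, Finset.card_biUnion]
    · simp_rw [Finset.card_image_of_injective _ List.cons_injective]
      calc d ^ (n + 1) = d * d ^ n := by ring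
        _ ≤ (Finset.univ.filter (R x)).card * d ^ n := Nat.mul_le_mul_right _ (h x)
        _ ≤ _ := by simpa using Finset.card_nsmul_le_sum _ _ _ fun y _ => ih y
    · intro y _ z _ hyz
      simp only [Function.onFun, Finset.disjoint_left, Finset.mem_image]
      rintro _ ⟨l, _, rfl⟩ ⟨m, _, hm⟩
      exact hyz (List.cons.inj hm).1.symm

/-- The `R`-chains of length `n`. -/
def chains (n : ℕ) : Finset (List A) :=
  if n = 0 then {[]} else Finset.univ.biUnion fun x => (chainsFrom R (n - 1) x).image (List.cons x)

theorem mem_chains {n : ℕ} {l : List A} :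
    l ∈ chains R n ↔ l.length = n ∧ List.IsChain R l := by
  cases n with
  | zero => cases l <;> simp [chains]
  | succ n => cases l <;> simp [chains, mem_chainsFrom]

theorem card_chains_le {v : A → ℝ} {r : ℝ} (hr : 1 ≤ r) (hv : ∀ x, 1 ≤ v x)
    (h : ∀ x, ∑ y with R x y, v y ≤ r * v x) (n : ℕ) :
    ((chains R n).card : ℝ) ≤ (1 + ∑ x, v x) * r ^ n := by
  have hs : 0 ≤ ∑ x, v x := Finset.sum_nonneg fun x _ => zero_le_one.trans (hv x)
  cases n with
  | zero => simpa [chains] using hs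
  | succ n =>
    have h1 : (chains R (n + 1)).card ≤ ∑ x, (chainsFrom R n x).card := by
      rw [chains, if_neg n.succ_ne_zero]
      exact Finset.card_biUnion_le.trans (Finset.sum_le_sum fun y _ => Finset.card_image_le)
    have h2 : r ^ n ≤ r ^ (n + 1) := pow_le_pow_right₀ hr n.le_succ
    have h3 : 0 ≤ r ^ n := by positivity
    calc ((chains R (n + 1)).card : ℝ) ≤ ∑ x, ((chainsFrom R n x).card : ℝ) := by exact_mod_cast h1
      _ ≤ ∑ x, r ^ n * v x :=
        Finset.sum_le_sum fun x _ => card_chainsFrom_le R (zero_le_one.trans hr) hv h n x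
      _ = r ^ n * ∑ x, v x := by rw [Finset.mul_sum]
      _ ≤ (1 + ∑ x, v x) * r ^ (n + 1) := by nlinarith

end ChainCount

section ReducedCount

variable {X : Type}

/-- The letter `b` may follow the letter `a` in a reduced word. -/
abbrev ReducedPair (a b : X × Bool) : Prop := a.1 = b.1 → a.2 = b.2

/-- The inverse letter. -/
abbrev invLetter (a : X × Bool) : X × Bool := (a.1, !a.2)

theorem reducedPair_iff {a b : X × Bool} : ReducedPair a b ↔ b ≠ invLetter a := by
  obtain ⟨x, s⟩ := a
  obtain ⟨y, t⟩ := b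
  cases s <;> cases t <;> simp [ReducedPair, invLetter, eq_comm]

/-- The letter `b` may follow `a` in a reduced word that does not contain `p q`. -/
abbrev AvoidPair (p q a b : X × Bool) : Prop := ReducedPair a b ∧ ¬ (a = p ∧ b = q)

theorem conjugator_length [DecidableEq X] (w : FreeGroup X) :
    2 * (FreeGroup.reduceCyclically.conjugator w.toWord).length +
      (FreeGroup.reduceCyclically w.toWord).length = w.norm := by
  have := congrArg List.length
    (FreeGroup.reduceCyclically.conj_conjugator_reduceCyclically w.toWord)
  simp only [List.length_append, FreeGroup.invRev_length] at this
  rw [FreeGroup.norm]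
  omega

variable [Fintype X] [DecidableEq X]

theorem filter_reducedPair (a : X × Bool) :
    Finset.univ.filter (ReducedPair a) = Finset.univ.erase (invLetter a) := by
  ext b
  simp only [Finset.mem_filter, Finset.mem_univ, true_and, reducedPair_iff, Finset.mem_erase,
    and_true]

theorem card_filter_reducedPair (a : X × Bool) :
    (Finset.univ.filter (ReducedPair a)).card = 2 * Fintype.card X - 1 := by
  rw [filter_reducedPair, Finset.card_erase_of_mem (Finset.mem_univ _)]
  simp [mul_comm]

theorem card_reduced_chains_le (hX : 2 ≤ Fintype.card X) (n : ℕ) :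
    ((chains (ReducedPair (X := X)) n).card : ℝ) ≤
      (1 + 2 * Fintype.card X) * (2 * Fintype.card X - 1) ^ n := by
  have hN : (2 : ℝ) ≤ Fintype.card X := by exact_mod_cast hX
  have := card_chains_le (ReducedPair (X := X)) (v := fun _ => 1)
    (r := 2 * Fintype.card X - 1) (by linarith) (fun _ => le_rfl) (fun a => by
      simp only [Finset.sum_const, card_filter_reducedPair]
      rw [nsmul_eq_mul, Nat.cast_sub (by omega)]
      simp) n
  simpa [mul_comm] using this

/-- A weight on letters that decreases towards the letter `p`. -/
def avoidWeight (δ : ℝ) (p a : X × Bool) : ℝ :=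
  2 * (1 + (if a = invLetter p then δ else 0) - if a = p then 2 * δ else 0)

theorem sum_avoidWeight (δ : ℝ) (p : X × Bool) :
    ∑ a, avoidWeight δ p a = 2 * (2 * Fintype.card X - δ) := by
  simp only [avoidWeight, ← Finset.mul_sum, Finset.sum_add_distrib, Finset.sum_sub_distrib]
  simp
  ring

theorem sum_avoidPair_le {p q : X × Bool} (hpq : ReducedPair p q) (hX : 2 ≤ Fintype.card X)
    {δ : ℝ} (hδ : δ = 1 / (4 * Fintype.card X - 1)) (a : X × Bool) :
    ∑ b with AvoidPair p q a b, avoidWeight δ p b ≤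
      (2 * Fintype.card X - 1 - δ) * avoidWeight δ p a := by
  have hN : (2 : ℝ) ≤ Fintype.card X := by exact_mod_cast hX
  have hδ' : δ * (4 * Fintype.card X - 1) = 1 := by
    rw [hδ]; exact one_div_mul_cancel (by linarith)
  have hδ0 : 0 < δ := by rw [hδ]; exact one_div_pos.2 (by linarith)
  have hδ1 : 7 * δ ≤ 1 := by nlinarith
  have hsum : ∀ a, ∑ b with ReducedPair a b, avoidWeight δ p b =
      2 * (2 * Fintype.card X - δ) - avoidWeight δ p (invLetter a) := fun a => by
    rw [filter_reducedPair, Finset.sum_erase_eq_sub (Finset.mem_univ _), sum_avoidWeight]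
  have hp : p ≠ invLetter p := fun h => by simpa [invLetter] using congrArg Prod.snd h
  have hp' : invLetter (invLetter p) = p := by simp [invLetter]
  by_cases ha : a = p
  · subst ha
    have hset : Finset.univ.filter (AvoidPair a q a) =
        (Finset.univ.filter (ReducedPair a)).erase q := by
      ext b
      simp [AvoidPair, and_comm]
    have hq : 2 * (1 - 2 * δ) ≤ avoidWeight δ a q := by
      unfold avoidWeight
      split_ifs <;> linarith
    rw [hset, Finset.sum_erase_eq_sub (by simpa using hpq), hsum]
    have h1 : avoidWeight δ a (invLetter a) = 2 * (1 + δ) := by simp [avoidWeight, hp.symm]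
    have h2 : avoidWeight δ a a = 2 * (1 - 2 * δ) := by simp [avoidWeight, hp]
    rw [h1, h2]
    nlinarith
  · have hset : Finset.univ.filter (AvoidPair p q a) = Finset.univ.filter (ReducedPair a) := by
      ext b
      simp [AvoidPair, ha]
    rw [hset, hsum]
    by_cases ha' : a = invLetter p
    · rw [ha', hp']
      have h1 : avoidWeight δ p (invLetter p) = 2 * (1 + δ) := by simp [avoidWeight, hp.symm]
      have h2 : avoidWeight δ p p = 2 * (1 - 2 * δ) := by simp [avoidWeight, hp]
      rw [h1, h2]
      nlinarith
    · have h3 : invLetter a ≠ p := fun h => ha' (by rw [← h]; simp [invLetter])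
      have h4 : invLetter a ≠ invLetter p := fun h => ha (by
        have := congrArg invLetter h
        simpa [invLetter] using this)
      have h1 : avoidWeight δ p (invLetter a) = 2 := by simp [avoidWeight, h3, h4]
      have h2 : avoidWeight δ p a = 2 := by simp [avoidWeight, ha, ha']
      rw [h1, h2]
      linarith

theorem exists_card_avoid_chains_le (hX : 2 ≤ Fintype.card X) :
    ∃ C r : ℝ, 0 ≤ C ∧ 2 * (Fintype.card X : ℝ) - 2 ≤ r ∧ r < 2 * Fintype.card X - 1 ∧
      ∀ p q : X × Bool, ReducedPair p q → ∀ n,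
        ((chains (AvoidPair p q) n).card : ℝ) ≤ C * r ^ n := by
  have hN : (2 : ℝ) ≤ Fintype.card X := by exact_mod_cast hX
  have hδ0 : 0 < 1 / (4 * (Fintype.card X : ℝ) - 1) := one_div_pos.2 (by linarith)
  have hδ1 : 1 / (4 * (Fintype.card X : ℝ) - 1) ≤ 1 / 7 :=
    one_div_le_one_div_of_le (by norm_num) (by linarith)
  obtain ⟨δ, hδ⟩ : ∃ δ, δ = 1 / (4 * (Fintype.card X : ℝ) - 1) := ⟨_, rfl⟩
  rw [← hδ] at hδ0 hδ1
  refine ⟨1 + 2 * (2 * Fintype.card X - δ), 2 * Fintype.card X - 1 - δ, by linarith, by linarith,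
    by linarith, fun p q hpq n => ?_⟩
  rw [← sum_avoidWeight δ p]
  refine card_chains_le _ (by linarith) (fun a => ?_) (sum_avoidPair_le hpq hX hδ) n
  unfold avoidWeight
  split_ifs <;> linarith

/-- The elements whose cyclic reduction does not contain some admissible pair of letters. -/
def MissesPair (w : FreeGroup X) : Prop :=
  ∃ p q : X × Bool, ReducedPair p q ∧
    List.IsChain (AvoidPair p q) (FreeGroup.reduceCyclically w.toWord)

theorem ncard_missesPair_le (n : ℕ) :
    ({w : FreeGroup X | MissesPair w} ∩ ballF X n).ncard ≤
      ∑ pq : (X × Bool) × (X × Bool) with ReducedPair pq.1 pq.2,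
        ∑ ij ∈ (Finset.range (n + 1) ×ˢ Finset.range (n + 1)) with 2 * ij.1 + ij.2 ≤ n,
          (chains (ReducedPair (X := X)) ij.1).card *
            (chains (AvoidPair pq.1 pq.2) ij.2).card := by
  let words : List (X × Bool) × List (X × Bool) → FreeGroup X := fun cu =>
    FreeGroup.mk (cu.1 ++ cu.2 ++ FreeGroup.invRev cu.1)
  let T : Finset (FreeGroup X) :=
    (Finset.univ.filter fun pq : (X × Bool) × (X × Bool) => ReducedPair pq.1 pq.2).biUnion
      fun pq => ((Finset.range (n + 1) ×ˢ Finset.range (n + 1)).filter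
        fun ij => 2 * ij.1 + ij.2 ≤ n).biUnion fun ij =>
          (chains (ReducedPair (X := X)) ij.1 ×ˢ chains (AvoidPair pq.1 pq.2) ij.2).image words
  have hsub : {w : FreeGroup X | MissesPair w} ∩ ballF X n ⊆ T := by
    rintro w ⟨⟨p, q, hpq, hw⟩, hn⟩
    have hlen := conjugator_length w
    have hn' : w.norm ≤ n := hn
    have hconj := FreeGroup.reduceCyclically.conj_conjugator_reduceCyclically w.toWord
    simp only [T, Finset.coe_biUnion, Set.mem_iUnion, Finset.mem_coe, Finset.mem_filter,
      Finset.mem_univ, true_and, Finset.mem_product, Finset.mem_range, Finset.mem_image, mem_chains]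
    refine ⟨(p, q), hpq, ((FreeGroup.reduceCyclically.conjugator w.toWord).length,
      (FreeGroup.reduceCyclically w.toWord).length),
      ⟨⟨by simp only; omega, by simp only; omega⟩, by simp only; omega⟩,
      (FreeGroup.reduceCyclically.conjugator w.toWord, FreeGroup.reduceCyclically w.toWord),
      ⟨⟨rfl, ?_⟩, rfl, hw⟩, ?_⟩
    · have hred := FreeGroup.isReduced_toWord (x := w)
      rw [← hconj, List.append_assoc] at hred
      exact List.IsChain.left_of_append hred
    · simp only [words, hconj, FreeGroup.mk_toWord]
  calc _ ≤ T.card := by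
        rw [← Set.ncard_coe_finset]
        exact Set.ncard_le_ncard hsub T.finite_toSet
    _ ≤ _ := Finset.card_biUnion_le.trans (Finset.sum_le_sum fun pq _ =>
        Finset.card_biUnion_le.trans (Finset.sum_le_sum fun ij _ =>
          Finset.card_image_le.trans (Finset.card_product _ _).le))

theorem finite_ballF (n : ℕ) : (ballF X n).Finite :=
  ((List.finite_length_le _ n).preimage FreeGroup.toWord_injective.injOn).subset
    fun w (hw : w.norm ≤ n) => hw

theorem pow_le_ncard_ballF (hX : 2 ≤ Fintype.card X) (n : ℕ) :
    (2 * Fintype.card X - 1) ^ n ≤ (ballF X n).ncard := by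
  obtain ⟨x⟩ : Nonempty X := Fintype.card_pos_iff.1 (by omega)
  have hred : ∀ l ∈ chainsFrom (ReducedPair (X := X)) n (x, true), FreeGroup.IsReduced l := by
    intro l hl
    exact ((mem_chainsFrom _).1 hl).2.tail
  calc _ ≤ (chainsFrom (ReducedPair (X := X)) n (x, true)).card :=
        pow_le_card_chainsFrom _ (fun a => (card_filter_reducedPair a).ge) n _
    _ = ((chainsFrom (ReducedPair (X := X)) n (x, true)).image FreeGroup.mk).card := by
        refine (Finset.card_image_of_injOn fun l hl m hm h => ?_).symm
        rw [← (hred l hl).reduce_eq, ← (hred m hm).reduce_eq]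
        exact FreeGroup.reduce.sound h
    _ ≤ _ := by
        rw [← Set.ncard_coe_finset]
        refine Set.ncard_le_ncard ?_ (finite_ballF n)
        intro w hw
        obtain ⟨l, hl, rfl⟩ := Finset.mem_image.1 hw
        exact FreeGroup.norm_mk_le.trans ((mem_chainsFrom _).1 hl).1.le

theorem exists_missesPair_bound (hX : 2 ≤ Fintype.card X) :
    ∃ C : ℝ, 0 < C ∧ ∃ s : ℝ, 0 < s ∧ s < 1 ∧ ∀ n : ℕ,
      (({w : FreeGroup X | MissesPair w} ∩ ballF X n).ncard : ℝ) ≤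
        C * s ^ n * ((ballF X n).ncard : ℝ) := by
  obtain ⟨C, r, hC, hr, hr', hchains⟩ := exists_card_avoid_chains_le hX
  have hN : (2 : ℝ) ≤ Fintype.card X := by exact_mod_cast hX
  obtain ⟨q, hq⟩ : ∃ q, q = 2 * (Fintype.card X : ℝ) - 1 := ⟨_, rfl⟩
  have hqr : q ≤ r ^ 2 := by nlinarith
  have hr0 : 0 < r := by linarith
  have hq0 : 0 < q := by linarith
  obtain ⟨K, hK⟩ : ∃ K : ℝ, K = (1 + 2 * Fintype.card X) * C := ⟨_, rfl⟩
  have hK0 : 0 ≤ K := by rw [hK]; positivity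
  obtain ⟨M, hM⟩ : ∃ M : ℕ, M =
    (Finset.univ.filter fun pq : (X × Bool) × (X × Bool) => ReducedPair pq.1 pq.2).card := ⟨_, rfl⟩
  have hcount : ∀ n, (({w : FreeGroup X | MissesPair w} ∩ ballF X n).ncard : ℝ) ≤
      M * K * ((n + 1 : ℝ) ^ 2 * r ^ n) := by
    intro n
    have hterm : ∀ pq : (X × Bool) × (X × Bool), ReducedPair pq.1 pq.2 → ∀ ij : ℕ × ℕ,
        2 * ij.1 + ij.2 ≤ n → ((chains (ReducedPair (X := X)) ij.1).card : ℝ) *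
          ((chains (AvoidPair pq.1 pq.2) ij.2).card : ℝ) ≤ K * r ^ n := by
      intro pq hpq ij hij
      calc _ ≤ ((1 + 2 * Fintype.card X) * q ^ ij.1) * (C * r ^ ij.2) := by
            rw [hq]
            refine mul_le_mul (card_reduced_chains_le hX _) (hchains _ _ hpq _) (by positivity) ?_
            rw [← hq]; positivity
        _ = K * (q ^ ij.1 * r ^ ij.2) := by rw [hK]; ring
        _ ≤ K * ((r ^ 2) ^ ij.1 * r ^ ij.2) := by gcongr
        _ = K * r ^ (2 * ij.1 + ij.2) := by rw [pow_add, pow_mul]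
        _ ≤ K * r ^ n := by
            gcongr
            linarith
    calc _ ≤ ((∑ pq : (X × Bool) × (X × Bool) with ReducedPair pq.1 pq.2,
        ∑ ij ∈ (Finset.range (n + 1) ×ˢ Finset.range (n + 1)) with 2 * ij.1 + ij.2 ≤ n,
          (chains (ReducedPair (X := X)) ij.1).card *
            (chains (AvoidPair pq.1 pq.2) ij.2).card : ℕ) : ℝ) := by
          exact_mod_cast ncard_missesPair_le n
      _ ≤ ∑ pq : (X × Bool) × (X × Bool) with ReducedPair pq.1 pq.2,
        ∑ ij ∈ (Finset.range (n + 1) ×ˢ Finset.range (n + 1)) with 2 * ij.1 + ij.2 ≤ n,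
          K * r ^ n := by
          push_cast
          exact Finset.sum_le_sum fun pq hpq => Finset.sum_le_sum fun ij hij =>
            hterm pq (Finset.mem_filter.1 hpq).2 ij (Finset.mem_filter.1 hij).2
      _ ≤ ∑ pq : (X × Bool) × (X × Bool) with ReducedPair pq.1 pq.2,
        ∑ ij ∈ Finset.range (n + 1) ×ˢ Finset.range (n + 1), K * r ^ n :=
          Finset.sum_le_sum fun pq _ => Finset.sum_le_sum_of_subset_of_nonneg
            (Finset.filter_subset _ _) fun _ _ _ => by positivity
      _ = _ := by
          simp only [Finset.sum_const, Finset.card_product, Finset.card_range, nsmul_eq_mul, hM]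
          push_cast
          ring
  obtain ⟨ρ, hρ⟩ : ∃ ρ, ρ = r / q := ⟨_, rfl⟩
  have hρ0 : 0 < ρ := by rw [hρ]; positivity
  have hρ1 : ρ < 1 := by rw [hρ, div_lt_one hq0]; linarith
  obtain ⟨s, hs, hs1⟩ := exists_between hρ1
  have hs0 : 0 < s := hρ0.trans hs
  have hlim := tendsto_pow_const_mul_const_pow_of_abs_lt_one 2 (r := ρ / s)
    (by rw [abs_of_pos (by positivity), div_lt_one hs0]; exact hs)
  obtain ⟨B, hB⟩ := hlim.bddAbove_range
  have hB' : ∀ n : ℕ, (n + 1 : ℝ) ^ 2 * ρ ^ n ≤ (B / (ρ / s)) * s ^ n := by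
    intro n
    have := hB ⟨n + 1, rfl⟩
    simp only [Nat.cast_add, Nat.cast_one] at this
    have h1 : (n + 1 : ℝ) ^ 2 * (ρ / s) ^ n ≤ B / (ρ / s) := by
      rw [le_div_iff₀ (by positivity)]
      calc _ = (n + 1 : ℝ) ^ 2 * (ρ / s) ^ (n + 1) := by ring
        _ ≤ B := this
    calc (n + 1 : ℝ) ^ 2 * ρ ^ n = ((n + 1 : ℝ) ^ 2 * (ρ / s) ^ n) * s ^ n := by
          rw [div_pow]; field_simp
      _ ≤ _ := by gcongr
  have hB0 : 0 ≤ B / (ρ / s) := by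
    have := hB' 0
    simp at this
    linarith
  refine ⟨M * K * (B / (ρ / s)) + 1, by positivity, s, hs0, hs1, fun n => ?_⟩
  have hball : q ^ n ≤ ((ballF X n).ncard : ℝ) := by
    have h := pow_le_ncard_ballF hX n
    have h' : (((2 * Fintype.card X - 1 : ℕ) : ℝ)) ^ n ≤ ((ballF X n).ncard : ℝ) := by
      exact_mod_cast h
    rw [Nat.cast_sub (by omega)] at h'
    rw [hq]
    simpa using h'
  calc _ ≤ M * K * ((n + 1 : ℝ) ^ 2 * r ^ n) := hcount n
    _ = M * K * ((n + 1 : ℝ) ^ 2 * ρ ^ n) * q ^ n := by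
        rw [hρ, div_pow]; field_simp
    _ ≤ M * K * ((B / (ρ / s)) * s ^ n) * q ^ n := by
        exact mul_le_mul_of_nonneg_right
          (mul_le_mul_of_nonneg_left (hB' n) (by positivity)) (by positivity)
    _ ≤ (M * K * (B / (ρ / s)) + 1) * s ^ n * q ^ n := by
        have : 0 ≤ s ^ n * q ^ n := by positivity
        nlinarith
    _ ≤ _ := by gcongr

end ReducedCount

section Cones

open FreeGroup

variable {X : Type}

theorem isReduced_invRev {l : List (X × Bool)} (h : IsReduced l) : IsReduced (invRev l) := by
  classical
  rw [isReduced_iff_reduce_eq] at h ⊢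
  rw [reduce_invRev, h]

theorem isCyclicallyReduced_invRev {l : List (X × Bool)} (h : IsCyclicallyReduced l) :
    IsCyclicallyReduced (invRev l) := by
  refine ⟨isReduced_invRev h.isReduced, ?_⟩
  intro a ha b hb hab
  simp only [invRev, List.getLast?_reverse, List.head?_reverse, List.head?_map, List.getLast?_map,
    Option.mem_def, Option.map_eq_some_iff] at ha hb
  obtain ⟨a', ha', rfl⟩ := ha
  obtain ⟨b', hb', rfl⟩ := hb
  simpa using (h.2 b' hb' a' ha' hab.symm).symm

/-- A set of group elements (given as a predicate) that changes along only finitely many edges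
of every Cayley graph. -/
def FiniteCoboundary {G : Type} [Group G] (χ : G → Prop) : Prop :=
  ∀ x : G, {g | ¬(χ (g * x) ↔ χ g)}.Finite

theorem FiniteCoboundary.comp {G : Type} [Group G] {χ : G → Prop} (h : FiniteCoboundary χ)
    (β : MulAut G) : FiniteCoboundary fun g => χ (β g) := by
  intro x
  refine ((h (β x)).preimage β.injective.injOn).subset fun g hg => ?_
  simpa using hg

theorem finiteCoboundary_of_generators {χ : FreeGroup X → Prop}
    (h : ∀ x : X, {g | ¬(χ (g * of x) ↔ χ g)}.Finite) : FiniteCoboundary χ := by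
  have hinv : ∀ y : FreeGroup X, {g | ¬(χ (g * y) ↔ χ g)}.Finite →
      {g | ¬(χ (g * y⁻¹) ↔ χ g)}.Finite := by
    intro y hy
    refine (hy.preimage (mul_left_injective y⁻¹).injOn).subset fun g hg => ?_
    simp only [Set.mem_preimage, Set.mem_ofPred_eq, inv_mul_cancel_right] at hg ⊢
    tauto
  intro x
  induction x using FreeGroup.induction_on with
  | C1 => simp
  | of x => exact h x
  | inv_of x ih => exact hinv _ (h x)
  | mul x y hx hy =>
    refine (hx.union (hy.preimage (mul_left_injective x).injOn)).subset fun g hg => ?_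
    simp only [Set.mem_union, Set.mem_preimage, Set.mem_ofPred_eq, ← mul_assoc] at hg ⊢
    tauto

variable [DecidableEq X]

/-- The elements whose reduced word begins with `L`. -/
def cone (L : List (X × Bool)) : Set (FreeGroup X) := {g | L <+: g.toWord}

theorem isReduced_of_cone_nonempty {L : List (X × Bool)} (h : (cone L).Nonempty) :
    IsReduced L := by
  obtain ⟨g, hg⟩ := h
  obtain ⟨t, ht⟩ := hg
  exact List.IsChain.left_of_append (ht ▸ isReduced_toWord (x := g))

theorem ray_mem_cone {u p q L : List (X × Bool)} {b : X × Bool} (hu : IsCyclicallyReduced u)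
    (hpq : u = p ++ b :: q) (hL : IsReduced (L ++ [b])) (k : ℕ) :
    (mk (L ++ b :: q) * mk u ^ k).toWord = L ++ b :: q ++ (List.replicate k u).flatten := by
  rw [pow_mk, mul_mk, toWord_mk]
  refine IsReduced.reduce_eq ?_
  have h1 : IsReduced (p ++ (b :: q ++ (List.replicate k u).flatten)) := by
    have := (hu.flatten_replicate (k + 1)).isReduced
    rwa [List.replicate_succ, List.flatten_cons, hpq, List.append_assoc, ← hpq] at this
  have h2 : IsReduced ([b] ++ (q ++ (List.replicate k u).flatten)) :=
    List.IsChain.right_of_append h1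
  simpa using hL.append_overlap h2 (by simp)

theorem infinite_of_ray {u p q L : List (X × Bool)} {b : X × Bool} (hu : IsCyclicallyReduced u)
    (hpq : u = p ++ b :: q) (hL : IsReduced (L ++ [b])) {s : Set (FreeGroup X)}
    (hs : ∀ k : ℕ, mk (L ++ b :: q) * mk u ^ k ∈ s) : (cone (L ++ [b]) ∩ s).Infinite := by
  have hinj : Function.Injective fun k : ℕ => mk (L ++ b :: q) * mk u ^ k := by
    intro k l hkl
    have h := congrArg (fun g => (toWord g).length) hkl
    simp only [ray_mem_cone hu hpq hL] at h
    have hpos : 0 < u.length := by simp [hpq]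
    simpa [hpos.ne'] using h
  refine (Set.infinite_range_of_injective hinj).mono ?_
  rintro _ ⟨k, rfl⟩
  refine ⟨?_, hs k⟩
  change _ <+: toWord _
  rw [ray_mem_cone hu hpq hL]
  exact ⟨q ++ (List.replicate k u).flatten, by simp⟩

theorem cone_turn {u p q L : List (X × Bool)} {a b : X × Bool} (hu : IsCyclicallyReduced u)
    (hpq : u = p ++ invLetter a :: b :: q) (ha : IsReduced (L ++ [a]))
    (hb : IsReduced (L ++ [b])) {χ : FreeGroup X → Prop} (hχ : ∀ g, χ (g * mk u) ↔ χ g) :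
    (cone (L ++ [a]) ∩ {g | χ g}).Infinite ∨ (cone (L ++ [b]) ∩ {g | ¬ χ g}).Infinite := by
  have hpow : ∀ (k : ℕ) g, χ (g * mk u ^ k) ↔ χ g := by
    intro k
    induction k with
    | zero => simp
    | succ k ih => intro g; rw [pow_succ, ← mul_assoc, hχ, ih]
  have hpow' : ∀ (k : ℕ) g, χ (g * (mk u)⁻¹ ^ k) ↔ χ g := fun k g => by
    rw [← hpow k (g * (mk u)⁻¹ ^ k), inv_pow, inv_mul_cancel_right]
  have hu' : invRev u = (invRev q ++ [invLetter b]) ++ a :: invRev p := by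
    rw [hpq]; simp [invRev, invLetter]
  have hstart : mk (L ++ a :: invRev p) * mk u = mk (L ++ b :: q) := by
    have : mk (L ++ a :: invRev p) = mk (L ++ b :: q) * (mk u)⁻¹ := by
      rw [inv_mk, mul_mk, hu']
      have h1 : mk (L ++ b :: q ++ (invRev q ++ [invLetter b] ++ a :: invRev p)) =
          mk L * (mk (b :: q) * mk (invRev (b :: q))) * mk (a :: invRev p) := by
        simp only [mul_mk]
        simp [invRev, invLetter]
      rw [h1, ← inv_mk, mul_inv_cancel, mul_one, mul_mk]
    rw [this, inv_mul_cancel_right]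
  have hend : χ (mk (L ++ b :: q)) ↔ χ (mk (L ++ a :: invRev p)) := by rw [← hstart, hχ]
  by_cases h : χ (mk (L ++ b :: q))
  · left
    refine infinite_of_ray (isCyclicallyReduced_invRev hu) hu' ha fun k => ?_
    rw [← inv_mk]
    exact (hpow' k _).2 (hend.1 h)
  · right
    exact infinite_of_ray hu (p := p ++ [invLetter a]) (by simp [hpq]) hb
      fun k => fun hk => h ((hpow k _).1 hk)

/-- The predicate `χ` is constant on the cone of `L`, up to finitely many elements. -/
def AlmostConstantOn (χ : FreeGroup X → Prop) (L : List (X × Bool)) : Prop :=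
  (cone L ∩ {g | χ g}).Finite ∨ (cone L ∩ {g | ¬ χ g}).Finite

theorem cone_subset (L : List (X × Bool)) :
    cone L ⊆ {mk L} ∪ ⋃ a, cone (L ++ [a]) := by
  rintro g ⟨t, ht⟩
  cases t with
  | nil =>
    left
    rw [List.append_nil] at ht
    simp [ht, mk_toWord]
  | cons a t =>
    right
    exact Set.mem_iUnion.2 ⟨a, t, by simpa using ht⟩

variable [Finite X]

theorem cone_inter_finite {L : List (X × Bool)} {s : Set (FreeGroup X)}
    (h : ∀ a, (cone (L ++ [a]) ∩ s).Finite) : (cone L ∩ s).Finite := by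
  refine ((Set.finite_singleton (mk L)).union (Set.finite_iUnion h)).subset ?_
  rintro g ⟨hg, hs⟩
  rcases cone_subset L hg with hg | hg
  · exact Or.inl hg
  · obtain ⟨a, ha⟩ := Set.mem_iUnion.1 hg
    exact Or.inr (Set.mem_iUnion.2 ⟨a, ha, hs⟩)

theorem AlmostConstantOn.of_extensions {u : List (X × Bool)} (hu : IsCyclicallyReduced u)
    (hturn : ∀ a b : X × Bool, ReducedPair a b → ∃ p q, u = p ++ a :: b :: q)
    {χ : FreeGroup X → Prop} (hχ : ∀ g, χ (g * mk u) ↔ χ g) {L : List (X × Bool)}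
    (h : ∀ a, AlmostConstantOn χ (L ++ [a])) : AlmostConstantOn χ L := by
  by_cases hall : ∀ a, (cone (L ++ [a]) ∩ {g | χ g}).Finite
  · exact Or.inl (cone_inter_finite hall)
  · push Not at hall
    obtain ⟨b, hb⟩ := hall
    have hbr := isReduced_of_cone_nonempty (hb.nonempty.mono Set.inter_subset_left)
    refine Or.inr (cone_inter_finite fun a => ?_)
    by_contra ha
    have har := isReduced_of_cone_nonempty
      ((Set.Infinite.nonempty ha).mono Set.inter_subset_left)
    have ha' := (h a).resolve_right ha
    have hb' := (h b).resolve_left hb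
    have hab : a ≠ b := fun hab => hb (hab ▸ ha')
    obtain ⟨p, q, hpq⟩ := hturn (invLetter a) b
      (reducedPair_iff.2 fun hba => hab (by rw [hba]; simp [invLetter]))
    rcases cone_turn hu hpq har hbr hχ with h' | h'
    · exact h' ha'
    · exact h' hb'

theorem exists_almostConstantOn {χ : FreeGroup X → Prop} (hfin : FiniteCoboundary χ) :
    ∃ M : ℕ, ∀ L : List (X × Bool), L.length = M → AlmostConstantOn χ L := by
  have hbad : (⋃ a : X × Bool, {g | ¬(χ (g * mk [a]) ↔ χ g)}).Finite :=
    Set.finite_iUnion fun a => hfin (mk [a])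
  obtain ⟨M, hM⟩ := (hbad.image FreeGroup.norm).bddAbove
  refine ⟨M + 1, fun L hL => ?_⟩
  have hconst : ∀ t : List (X × Bool), IsReduced (L ++ t) → (χ (mk (L ++ t)) ↔ χ (mk L)) := by
    intro t
    induction t using List.reverseRecOn with
    | nil => simp
    | append_singleton t a ih =>
      intro hred
      rw [← List.append_assoc] at hred ⊢
      have hred' : IsReduced (L ++ t) := List.IsChain.left_of_append hred
      rw [← ih hred', ← mul_mk]
      by_contra hne
      have h1 := hM ⟨mk (L ++ t), Set.mem_iUnion.2 ⟨a, hne⟩, rfl⟩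
      rw [FreeGroup.norm, toWord_mk, hred'.reduce_eq, List.length_append] at h1
      omega
  have hcone : ∀ g ∈ cone L, (χ g ↔ χ (mk L)) := by
    rintro g ⟨t, ht⟩
    have := hconst t (ht ▸ isReduced_toWord)
    rwa [ht, mk_toWord] at this
  by_cases h : χ (mk L)
  · right
    convert Set.finite_empty
    ext g
    simpa using fun hg => (hcone g hg).2 h
  · left
    convert Set.finite_empty
    ext g
    simpa using fun hg hg' => h ((hcone g hg).1 hg')

theorem finite_or_cofinite_of_invariant {u : List (X × Bool)} (hu : IsCyclicallyReduced u)
    (hturn : ∀ a b : X × Bool, ReducedPair a b → ∃ p q, u = p ++ a :: b :: q)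
    {χ : FreeGroup X → Prop} (hfin : FiniteCoboundary χ) (hχ : ∀ g, χ (g * mk u) ↔ χ g) :
    {g | χ g}.Finite ∨ {g | ¬ χ g}.Finite := by
  obtain ⟨M, hM⟩ := exists_almostConstantOn hfin
  have hdesc : ∀ d ≤ M, ∀ L : List (X × Bool), L.length + d = M → AlmostConstantOn χ L := by
    intro d
    induction d with
    | zero => intro _ L hL; exact hM L hL
    | succ d ih =>
      intro hd L hL
      refine AlmostConstantOn.of_extensions hu hturn hχ fun a => ih (by omega) _ ?_
      simp only [List.length_append, List.length_singleton]
      omega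
  have h := hdesc M le_rfl [] (by simp)
  have huniv : (cone [] : Set (FreeGroup X)) = Set.univ := by
    ext g; simp [cone]
  simpa [AlmostConstantOn, huniv] using h

end Cones

section FreeFactor

open FreeGroup

variable {X : Type} [DecidableEq X]

/-- The reduced word of `g` begins with the positive letter `y`. -/
def BeginsWith (y : X) (g : FreeGroup X) : Prop := g.toWord.head? = some (y, true)

theorem beginsWith_mul_of {y z : X} {g : FreeGroup X} (h : ¬(z = y ∧ g = 1)) :
    BeginsWith y (g * of z) ↔ BeginsWith y g := by
  rcases List.eq_nil_or_concat g.toWord with hg | ⟨l, ⟨x, s⟩, hg⟩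
  · have hg1 : g = 1 := toWord_eq_nil_iff.1 hg
    subst hg1
    simpa [BeginsWith] using fun hz => h ⟨hz, rfl⟩
  · rw [List.concat_eq_append] at hg
    by_cases hc : x = z ∧ s = false
    · obtain ⟨rfl, rfl⟩ := hc
      have hl : IsReduced l :=
        List.IsChain.left_of_append (hg ▸ isReduced_toWord (x := g))
      have hmul : g * of x = mk l := by
        rw [← mk_toWord (x := g), hg, ← mul_mk]
        have : (mk [(x, false)] : FreeGroup X) = (of x)⁻¹ := rfl
        rw [this, inv_mul_cancel_right]
      rw [BeginsWith, BeginsWith, hmul, toWord_mk, hl.reduce_eq, hg]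
      cases l <;> simp
    · have hred : IsReduced (l ++ [(x, s)] ++ [(z, true)]) := by
        refine IsReduced.append_overlap (L₂ := [(x, s)]) ?_ ?_ (by simp)
        · rw [← hg]; exact isReduced_toWord
        · simpa using hc
      have hmul : (g * of z).toWord = l ++ [(x, s)] ++ [(z, true)] := by
        rw [toWord_mul, hg, toWord_of, hred.reduce_eq]
      rw [BeginsWith, BeginsWith, hmul, hg]
      cases l <;> simp

theorem finiteCoboundary_beginsWith (y : X) : FiniteCoboundary (BeginsWith y) := by
  refine finiteCoboundary_of_generators fun z => (Set.finite_singleton 1).subset fun g hg => ?_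
  by_contra h1
  exact hg (beginsWith_mul_of fun h => h1 h.2)

theorem beginsWith_mul_of_mem_closure {y : X} {S : Set X} (hy : y ∉ S) {w : FreeGroup X}
    (hw : w ∈ Subgroup.closure (of '' S)) (g : FreeGroup X) :
    BeginsWith y (g * w) ↔ BeginsWith y g := by
  induction hw using Subgroup.closure_induction generalizing g with
  | mem w hw =>
    obtain ⟨z, hz, rfl⟩ := hw
    exact beginsWith_mul_of fun h => hy (h.1 ▸ hz)
  | one => simp
  | mul a b _ _ ha hb => rw [← mul_assoc, hb, ha]
  | inv a _ ha => rw [← ha (g * a⁻¹), inv_mul_cancel_right]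

theorem infinite_beginsWith (y : X) : {g | BeginsWith y g}.Infinite := by
  have hinj : Function.Injective fun n : ℕ => of y ^ (n + 1) := fun m n h => by
    simpa using congrArg FreeGroup.norm h
  refine (Set.infinite_range_of_injective hinj).mono ?_
  rintro _ ⟨n, rfl⟩
  simp [BeginsWith, List.replicate_succ]

theorem infinite_not_beginsWith {y z : X} (hz : z ≠ y) : {g | ¬ BeginsWith y g}.Infinite := by
  refine (infinite_beginsWith z).mono fun g hg hg' => hz ?_
  simpa using Option.some.inj (hg.symm.trans hg')

theorem missesPair_of_mem_freeFactor [Finite X] [Nontrivial X] {α : MulAut (FreeGroup X)}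
    {S : Set X} (hS : S ⊂ Set.univ) {w : FreeGroup X}
    (hw : w ∈ α '' (Subgroup.closure (of '' S) : Set (FreeGroup X))) : MissesPair w := by
  obtain ⟨y, -, hy⟩ := Set.exists_of_ssubset hS
  obtain ⟨s, hs, rfl⟩ := hw
  by_contra hmiss
  let c : FreeGroup X := mk (reduceCyclically.conjugator (α s).toWord)
  let u := reduceCyclically (α s).toWord
  have hu : IsCyclicallyReduced u := reduceCyclically.isCyclicallyReduced isReduced_toWord
  have hconj : c * mk u * c⁻¹ = α s := by
    rw [inv_mk, mul_mk, mul_mk, reduceCyclically.conj_conjugator_reduceCyclically, mk_toWord]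
  have hturn : ∀ a b : X × Bool, ReducedPair a b → ∃ p q, u = p ++ a :: b :: q := by
    intro a b hab
    by_contra hno
    refine hmiss ⟨a, b, hab, ?_⟩
    rw [List.isChain_iff_forall_rel_of_append_cons_cons]
    intro a' b' l₁ l₂ hl
    refine ⟨List.isChain_iff_forall_rel_of_append_cons_cons.1 hu.isReduced hl, ?_⟩
    rintro ⟨rfl, rfl⟩
    exact hno ⟨l₁, l₂, hl⟩
  let β : MulAut (FreeGroup X) := α⁻¹ * MulAut.conj c
  have hβ : β (mk u) = s := by
    simp only [β, MulAut.mul_apply, MulAut.conj_apply, hconj, MulAut.inv_apply_self]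
  obtain ⟨z, hz⟩ := exists_ne y
  have hpre : ∀ P : FreeGroup X → Prop, {g | P g}.Infinite → {g | P (β g)}.Infinite :=
    fun P hP hfin => hP <| (hfin.image β).subset fun g hg =>
      ⟨β.symm g, by simpa using hg, by simp⟩
  rcases finite_or_cofinite_of_invariant hu hturn ((finiteCoboundary_beginsWith y).comp β)
    (fun g => by
      rw [show β (g * mk u) = β g * s from (map_mul β g (mk u)).trans (congrArg _ hβ),
        beginsWith_mul_of_mem_closure hy hs]) with h | h
  · exact hpre _ (infinite_beginsWith y) h
  · exact hpre _ (infinite_not_beginsWith hz) h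

end FreeFactor

/-- the set of elements of F(X) lying in a proper free factor, i.e.
{w : w ∈ α(⟨S⟩) for some α ∈ Aut F(X) and some proper S ⊊ X}, is exponentially
F(X)-negligible (its complement is exponentially F(X)-generic). -/
theorem statement3 (X : Type) [Fintype X] [DecidableEq X] (hX : 2 ≤ Fintype.card X) :
    ExpGeneric
      (Set.univ \ {w : FreeGroup X | ∃ α : MulAut (FreeGroup X), ∃ S : Set X,
        S ⊂ Set.univ ∧
        w ∈ α '' ((Subgroup.closure (FreeGroup.of '' S) : Subgroup (FreeGroup X)) :
          Set (FreeGroup X))})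
      (Set.univ : Set (FreeGroup X)) := by
  obtain ⟨C, hC, s, hs, hs1, h⟩ := exists_missesPair_bound hX
  have : Nontrivial X := Fintype.one_lt_card_iff_nontrivial.1 hX
  refine ⟨C, hC, s, hs, hs1, fun n => ?_⟩
  rw [Set.univ_inter]
  refine le_trans ?_ (h n)
  refine Nat.cast_le.2 (Set.ncard_le_ncard ?_ ((finite_ballF n).inter_of_right _))
  rintro w ⟨hw, hn⟩
  rw [sdiff_sdiff_right_self] at hw
  obtain ⟨α, S, hS, hw⟩ := hw.2
  exact ⟨missesPair_of_mem_freeFactor hS hw, hn⟩
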